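/- Let u ∈ (−1, 0) and λ ∈ ℝ, and for m ∈ ℤ let v_{2m+1}^{(iλ)}(x) = (1+x²)^{−(1+iλ)/2} e^{i(2m+1)θ(x)} with θ(x) = arccot(x) ∈ (0,π). Then there exists a constant c_u > 0 such that for all m ∈ ℤ: ⫴v_{2m+1}^{(iλ)}⫴²_u := ∫₀^{2π} ∫_ℝ |ξ|^{−u} |𝓕(π_{iλ,−}(k_{θ₀}) v_{2m+1}^{(iλ)})(ξ)|² dξ dθ₀ ≤ c_u (1+|m|)^{−u} (the inner improper Fourier transforms existing for all ξ ≠ 0). -/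

import Mathlib

open MeasureTheory Real Set Filter Complex
open scoped ENNReal NNReal

noncomputable section

/-- The weight-`2m` K-type vector `v_{2m}^{(u)}(x) = (1+x²)^{−(1+u)/2} ((1+xi)/(1−xi))^m`
of the principal series `P(u,+)` in the noncompact picture. -/
def vEven (u : ℂ) (m : ℤ) (x : ℝ) : ℂ :=
  ((1 + x ^ 2 : ℝ) : ℂ) ^ (-(1 + u) / 2) *
    ((1 + (x : ℂ) * Complex.I) / (1 - (x : ℂ) * Complex.I)) ^ m

/-- `z` is the improper Fourier transform of `g` at `ξ`:
`z = lim_{R→∞} ∫_{−R}^R g(x) e^{−2πixξ} dx`. -/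
def IsImpFT (g : ℝ → ℂ) (ξ : ℝ) (z : ℂ) : Prop :=
  Filter.Tendsto
    (fun R : ℝ => ∫ x in Set.Ioc (-R) R,
      g x * Complex.exp (-2 * (Real.pi : ℂ) * Complex.I * (x : ℂ) * (ξ : ℂ)))
    Filter.atTop (nhds z)

/-- The principal-series rotation action
`(π_{s,+}(k_θ)v)(x) = |cos θ − x sin θ|^{−1−s} v((x cos θ + sin θ)/(cos θ − x sin θ))`. -/
def piPlus (s : ℂ) (θ : ℝ) (v : ℝ → ℂ) (x : ℝ) : ℂ :=
  ((|Real.cos θ - x * Real.sin θ| : ℝ) : ℂ) ^ (-1 - s) *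
    v ((x * Real.cos θ + Real.sin θ) / (Real.cos θ - x * Real.sin θ))

/-- The nonspherical principal-series rotation action, with the sign factor
`sgn(cos θ − x sin θ)`. -/
def piMinus (s : ℂ) (θ : ℝ) (v : ℝ → ℂ) (x : ℝ) : ℂ :=
  ((Real.sign (Real.cos θ - x * Real.sin θ) : ℝ) : ℂ) *
    ((|Real.cos θ - x * Real.sin θ| : ℝ) : ℂ) ^ (-1 - s) *
    v ((x * Real.cos θ + Real.sin θ) / (Real.cos θ - x * Real.sin θ))

/-- `arccot x = π/2 − arctan x ∈ (0, π)`. -/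
def arccot (x : ℝ) : ℝ := Real.pi / 2 - Real.arctan x

/-- The odd-weight K-type vector
`v_{2m+1}^{(iλ)}(x) = (1+x²)^{−(1+iλ)/2} e^{i(2m+1)arccot x}` of `P(iλ,−)`. -/
def vOdd (lam : ℝ) (m : ℤ) (x : ℝ) : ℂ :=
  ((1 + x ^ 2 : ℝ) : ℂ) ^ (-(1 + Complex.I * lam) / 2) *
    Complex.exp (Complex.I * (2 * (m : ℂ) + 1) * (arccot x : ℂ))

open scoped FourierTransform

/-- Fourier multiplication formula against a Schwartz function. -/
lemma integral_schwartz_smul_fourier {f : ℝ → ℂ} (hf : Integrable f) (φ : SchwartzMap ℝ ℂ) :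
    ∫ x, φ x • 𝓕 f x = ∫ x, 𝓕 (φ : ℝ → ℂ) x • f x := by
  simpa using! (VectorFourier.integral_fourierIntegral_smul_eq_flip (L := innerₗ ℝ)
    Real.continuous_fourierChar continuous_inner φ.integrable hf).symm

lemma continuous_fourier {f : ℝ → ℂ} (hf : Integrable f) : Continuous (𝓕 f) :=
  VectorFourier.fourierIntegral_continuous Real.continuous_fourierChar
    (L := innerₗ ℝ) continuous_inner hf

/-- On `L¹ ∩ L²` the `L²` Fourier transform agrees with the Fourier integral. -/
lemma fourier_toLp_ae_eq {f : ℝ → ℂ} (h1 : Integrable f) (h2 : MemLp f 2) :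
    (𝓕 (h2.toLp f) : Lp ℂ 2 (volume : Measure ℝ)) =ᵐ[volume] 𝓕 f := by
  refine ae_eq_of_integral_contDiff_smul_eq
    ((Lp.memLp _).locallyIntegrable (by norm_num)) (continuous_fourier h1).locallyIntegrable ?_
  intro g hg hgc
  have hg₁ : HasCompactSupport (Complex.ofRealCLM ∘ g) := hgc.comp_left rfl
  have hg₂ : ContDiff ℝ (↑(⊤ : ℕ∞)) (Complex.ofRealCLM ∘ g) := by fun_prop
  set φ : SchwartzMap ℝ ℂ := hg₁.toSchwartzMap hg₂ with hφ
  have e : ∀ (h : ℝ → ℂ), ∫ x, g x • h x = ∫ x, φ x • h x := fun h => by simp [φ]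
  rw [e, e, integral_schwartz_smul_fourier h1, ← Lp.toTemperedDistribution_apply,
    ← Lp.fourier_toTemperedDistribution_eq, TemperedDistribution.fourier_apply,
    Lp.toTemperedDistribution_apply, SchwartzMap.fourier_coe]
  refine integral_congr_ae ?_
  filter_upwards [h2.coeFn_toLp] with x hx
  rw [hx]

/-- Plancherel's theorem for the Fourier integral on `L¹ ∩ L²`. -/
lemma lintegral_enorm_fourier_sq {f : ℝ → ℂ} (h1 : Integrable f) (h2 : MemLp f 2) :
    ∫⁻ ξ, ‖𝓕 f ξ‖ₑ ^ 2 = ∫⁻ x, ‖f x‖ₑ ^ 2 := by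
  have key : eLpNorm (𝓕 f) 2 volume = eLpNorm f 2 volume := by
    rw [← eLpNorm_congr_ae (fourier_toLp_ae_eq h1 h2), ← eLpNorm_congr_ae h2.coeFn_toLp,
      ← Lp.enorm_def, ← Lp.enorm_def, ← ofReal_norm, ← ofReal_norm, Lp.norm_fourier_eq]
  have sq : ∀ g : ℝ → ℂ, ∫⁻ x, ‖g x‖ₑ ^ 2 = eLpNorm g 2 volume ^ 2 := fun g => by
    have := eLpNorm_nnreal_pow_eq_lintegral (μ := volume) (f := g) (p := 2) (by norm_num)
    simpa using this.symm
  rw [sq, sq, key]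

lemma fourier_eq_integral_mul_exp (f : ℝ → ℂ) (ξ : ℝ) :
    𝓕 f ξ = ∫ x, f x * Complex.exp (-2 * (Real.pi : ℂ) * Complex.I * (x : ℂ) * (ξ : ℂ)) := by
  rw [Real.fourier_real_eq_integral_exp_smul]
  refine integral_congr_ae (.of_forall fun x => ?_)
  simp only [smul_eq_mul]
  rw [mul_comm]
  congr 2
  push_cast
  ring

/-- Fatou's lemma bounds the `L²` norm of an improper Fourier transform. -/
lemma IsImpFT.lintegral_enorm_sq_le {g G : ℝ → ℂ} (hg : Continuous g)
    (h : ∀ ξ : ℝ, ξ ≠ 0 → IsImpFT g ξ (G ξ)) :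
    ∫⁻ ξ, ‖G ξ‖ₑ ^ 2 ≤ ∫⁻ x, ‖g x‖ₑ ^ 2 := by
  set f : ℕ → ℝ → ℂ := fun n => (Ioc (-(n : ℝ)) n).indicator g with hf
  have hF : ∀ n ξ, 𝓕 (f n) ξ = ∫ x in Ioc (-(n : ℝ)) n,
      g x * Complex.exp (-2 * (Real.pi : ℂ) * Complex.I * (x : ℂ) * (ξ : ℂ)) := fun n ξ => by
    rw [fourier_eq_integral_mul_exp, ← integral_indicator measurableSet_Ioc]
    simp only [hf, Set.indicator_mul_left]
  have hmem : ∀ n (p : ℝ≥0∞), MemLp (f n) p := fun n p => by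
    rw [memLp_indicator_iff_restrict measurableSet_Ioc]
    obtain ⟨C, hC⟩ := (isCompact_Icc (a := -(n : ℝ)) (b := n)).exists_bound_of_continuousOn
      hg.continuousOn
    refine MemLp.of_bound hg.aestronglyMeasurable C ?_
    filter_upwards [ae_restrict_mem measurableSet_Ioc] with x hx using hC x (Ioc_subset_Icc_self hx)
  have hlim : ∀ᵐ ξ : ℝ, ‖G ξ‖ₑ ^ 2 = liminf (fun n => ‖𝓕 (f n) ξ‖ₑ ^ 2) atTop := by
    filter_upwards [compl_mem_ae_iff.2 (measure_singleton (0 : ℝ))] with ξ hξ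
    refine (Tendsto.liminf_eq ?_).symm
    have h0 := (h ξ hξ).comp tendsto_natCast_atTop_atTop
    simp only [hF]
    exact ((ENNReal.continuous_pow 2).tendsto _).comp ((continuous_enorm.tendsto _).comp h0)
  rw [lintegral_congr_ae hlim]
  have hint : ∀ n, Integrable (f n) := fun n => memLp_one_iff_integrable.1 (hmem n 1)
  refine (lintegral_liminf_le fun n =>
    ((continuous_fourier (hint n)).enorm.measurable.pow_const 2)).trans ?_
  refine liminf_le_of_frequently_le' (.of_forall fun n => ?_)
  rw [lintegral_enorm_fourier_sq (hint n) (hmem n 2)]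
  refine lintegral_mono fun x => ?_
  gcongr
  exact enorm_indicator_le_enorm_self _ _

/-- A `C¹` function vanishing at infinity with integrable derivative has an improper Fourier
transform away from the origin, given by integration by parts. -/
lemma isImpFT_of_hasDerivAt {g g' : ℝ → ℂ} (hd : ∀ x, HasDerivAt g (g' x) x)
    (hc : Continuous g') (hi : Integrable g') (hbot : Tendsto g atBot (nhds 0))
    (htop : Tendsto g atTop (nhds 0)) {ξ : ℝ} (hξ : ξ ≠ 0) :
    IsImpFT g ξ (𝓕 g' ξ / (2 * Real.pi * Complex.I * ξ)) := by
  set a : ℂ := -2 * Real.pi * Complex.I * ξ with ha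
  have ha0 : a ≠ 0 := by simp [ha, hξ, Real.pi_ne_zero]
  set e : ℝ → ℂ := fun x => Complex.exp (-2 * (Real.pi : ℂ) * Complex.I * (x : ℂ) * (ξ : ℂ)) with he
  have hen : ∀ x, ‖e x‖ = 1 := fun x => by
    have : e x = Complex.exp (((-2 * Real.pi * x * ξ : ℝ) : ℂ) * Complex.I) := by
      simp only [he]; congr 1; push_cast; ring
    rw [this, Complex.norm_exp_ofReal_mul_I]
  have hed : ∀ x, HasDerivAt (fun x => e x / a) (e x) x := fun x => by
    have h1 : HasDerivAt (fun x : ℝ => a * (x : ℂ)) a x := by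
      simpa using (Complex.ofRealCLM.hasDerivAt (x := x)).const_mul a
    have h2 := h1.cexp.div_const a
    have h3 : ∀ y : ℝ, e y = Complex.exp (a * y) := fun y => by
      simp only [he, ha]; congr 1; ring
    simp only [h3]
    simpa [ha0] using h2
  have hec : Continuous e := by fun_prop
  have hparts : ∀ R : ℝ, 0 ≤ R → ∫ x in Ioc (-R) R, g x * e x =
      g R * (e R / a) - g (-R) * (e (-R) / a) - ∫ x in (-R)..R, g' x * (e x / a) := fun R hR => by
    rw [← intervalIntegral.integral_of_le (by linarith)]
    exact intervalIntegral.integral_mul_deriv_eq_deriv_mul (fun x _ => hd x) (fun x _ => hed x)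
      (hc.intervalIntegrable _ _) (hec.intervalIntegrable _ _)
  have hbd : Integrable fun x => g' x * (e x / a) :=
    hi.mul_bdd (c := ‖a‖⁻¹) (hec.div_const a).aestronglyMeasurable
      (.of_forall fun x => by simp [hen])
  have hz : ∀ {l : Filter ℝ}, Tendsto g l (nhds 0) → Tendsto (fun x => g x * (e x / a)) l (nhds 0) :=
    fun {l} hl => by
      rw [tendsto_zero_iff_norm_tendsto_zero] at hl ⊢
      simpa [hen] using hl.mul_const (‖a‖⁻¹)
  have hval : 𝓕 g' ξ / (2 * Real.pi * Complex.I * ξ) = 0 - 0 - ∫ x, g' x * (e x / a) := by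
    rw [fourier_eq_integral_mul_exp]
    simp only [← mul_div_assoc, integral_div]
    rw [show (2 * Real.pi * Complex.I * ξ : ℂ) = -a by rw [ha]; ring]
    rw [div_neg]; ring
  unfold IsImpFT
  rw [hval]
  refine Tendsto.congr' (f₁ := fun R : ℝ => g R * (e R / a) - g (-R) * (e (-R) / a) -
    ∫ x in (-R)..R, g' x * (e x / a)) ?_ ?_
  · filter_upwards [eventually_ge_atTop 0] with R hR using (hparts R hR).symm
  · exact ((hz htop).sub ((hz hbot).comp tendsto_neg_atTop_atBot)).sub
      (intervalIntegral_tendsto_integral hbd tendsto_neg_atTop_atBot tendsto_id)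

lemma abs_rpow_le_add {a M : ℝ} (ha : a ∈ Ioo (0 : ℝ) 1) (hM : 0 < M) (ξ : ℝ) :
    |ξ| ^ a ≤ M ^ a + M ^ (a - 2) * |ξ| ^ 2 := by
  obtain ⟨h0, h1⟩ := ha
  rcases le_total |ξ| M with h | h
  · have := rpow_le_rpow (abs_nonneg ξ) h h0.le
    have : 0 ≤ M ^ (a - 2) * |ξ| ^ 2 := by positivity
    linarith
  · have hξ : 0 < |ξ| := hM.trans_le h
    have e : |ξ| ^ a = |ξ| ^ (a - 2) * |ξ| ^ 2 := by
      rw [← rpow_natCast, ← rpow_add hξ]; norm_num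
    have h2 : |ξ| ^ (a - 2) ≤ M ^ (a - 2) := rpow_le_rpow_of_nonpos hM h (by linarith)
    have : 0 ≤ M ^ a := by positivity
    rw [e]
    nlinarith [mul_le_mul_of_nonneg_right h2 (sq_nonneg |ξ|)]

lemma vOdd_eq_exp (lam : ℝ) (m : ℤ) (x : ℝ) :
    vOdd lam m x = Complex.exp ((Real.log (1 + x ^ 2) : ℝ) * (-(1 + Complex.I * lam) / 2) +
      Complex.I * (2 * (m : ℂ) + 1) * (arccot x : ℂ)) := by
  have h : (0 : ℝ) < 1 + x ^ 2 := by positivity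
  rw [vOdd, Complex.cpow_def_of_ne_zero (by exact_mod_cast h.ne'), Complex.exp_add,
    Complex.ofReal_log h.le]

lemma norm_vOdd (lam : ℝ) (m : ℤ) (x : ℝ) : ‖vOdd lam m x‖ = (√(1 + x ^ 2))⁻¹ := by
  have h : (0 : ℝ) < 1 + x ^ 2 := by positivity
  have e : ((Real.log (1 + x ^ 2) : ℝ) * (-(1 + Complex.I * lam) / 2) +
      Complex.I * (2 * (m : ℂ) + 1) * (arccot x : ℂ)).re = -(Real.log (1 + x ^ 2) / 2) := by
    simp [Complex.add_re, Complex.mul_re, Complex.mul_im]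
    ring
  rw [vOdd_eq_exp, Complex.norm_exp, e, Real.exp_neg, ← Real.log_sqrt h.le,
    Real.exp_log (Real.sqrt_pos.2 h)]

/-- The derivative of `vOdd lam m`. -/
def vOddDeriv (lam : ℝ) (m : ℤ) (x : ℝ) : ℂ :=
  vOdd lam m x * (((-(1 + Complex.I * lam) * x - Complex.I * (2 * (m : ℂ) + 1))) /
    ((1 + x ^ 2 : ℝ) : ℂ))

lemma hasDerivAt_vOdd (lam : ℝ) (m : ℤ) (x : ℝ) :
    HasDerivAt (vOdd lam m) (vOddDeriv lam m x) x := by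
  have h : (0 : ℝ) < 1 + x ^ 2 := by positivity
  have h0 : ((1 + x ^ 2 : ℝ) : ℂ) ≠ 0 := by exact_mod_cast h.ne'
  have hlog : HasDerivAt (fun y : ℝ => Real.log (1 + y ^ 2)) (2 * x / (1 + x ^ 2)) x := by
    simpa using ((hasDerivAt_pow 2 x).const_add 1).log h.ne'
  have harc : HasDerivAt arccot (-(1 / (1 + x ^ 2))) x :=
    (Real.hasDerivAt_arctan x).const_sub (Real.pi / 2)
  have hd := ((hlog.ofReal_comp.mul_const (-(1 + Complex.I * lam) / 2)).add
    (harc.ofReal_comp.const_mul (Complex.I * (2 * (m : ℂ) + 1)))).cexp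
  have hv : vOdd lam m = fun y : ℝ => Complex.exp ((Real.log (1 + y ^ 2) : ℝ) *
      (-(1 + Complex.I * lam) / 2) + Complex.I * (2 * (m : ℂ) + 1) * (arccot y : ℂ)) :=
    funext (vOdd_eq_exp lam m)
  rw [vOddDeriv, vOdd_eq_exp, hv]
  refine hd.congr_deriv ?_
  simp only [Pi.add_apply]
  congr 1
  push_cast at h0 ⊢
  field_simp
  ring

lemma continuous_vOdd (lam : ℝ) (m : ℤ) : Continuous (vOdd lam m) :=
  continuous_iff_continuousAt.2 fun x => (hasDerivAt_vOdd lam m x).continuousAt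

lemma continuous_vOddDeriv (lam : ℝ) (m : ℤ) : Continuous (vOddDeriv lam m) := by
  refine (continuous_vOdd lam m).mul (Continuous.div (by fun_prop) (by fun_prop) fun x => ?_)
  have h : (0 : ℝ) < 1 + x ^ 2 := by positivity
  exact_mod_cast h.ne'

lemma norm_vOddDeriv_le (lam : ℝ) (m : ℤ) (x : ℝ) :
    ‖vOddDeriv lam m x‖ ≤ (2 + |lam|) * (1 + |(m : ℝ)|) * (1 + x ^ 2)⁻¹ := by
  have h : (0 : ℝ) < 1 + x ^ 2 := by positivity
  set s := √(1 + x ^ 2) with hs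
  have hs0 : 0 < s := Real.sqrt_pos.2 h
  have hss : s * s = 1 + x ^ 2 := Real.mul_self_sqrt h.le
  have h1 : 1 ≤ s := Real.one_le_sqrt.2 (by nlinarith)
  have hx : |x| ≤ s := Real.abs_le_sqrt (by linarith)
  have hA : ‖(1 + Complex.I * lam : ℂ)‖ ≤ 1 + |lam| :=
    (norm_add_le _ _).trans (by simp)
  have hB : ‖(2 * (m : ℂ) + 1)‖ ≤ 2 * |(m : ℝ)| + 1 :=
    (norm_add_le _ _).trans (by simp)
  have hnum : ‖(-(1 + Complex.I * lam) * x - Complex.I * (2 * (m : ℂ) + 1))‖ ≤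
      (2 + |lam|) * (1 + |(m : ℝ)|) * s := by
    calc _ ≤ ‖(1 + Complex.I * lam : ℂ)‖ * |x| + ‖(2 * (m : ℂ) + 1)‖ := by
          refine (norm_sub_le _ _).trans_eq ?_
          rw [norm_mul, norm_mul, norm_neg, Complex.norm_I, one_mul, Complex.norm_real,
            Real.norm_eq_abs]
      _ ≤ (1 + |lam|) * s + (2 * |(m : ℝ)| + 1) * s := by
          have := mul_le_mul hA hx (abs_nonneg x) (by positivity)
          have : (2 * |(m : ℝ)| + 1) * 1 ≤ (2 * |(m : ℝ)| + 1) * s := by gcongr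
          linarith
      _ ≤ _ := by
          have : 0 ≤ |lam| * |(m : ℝ)| * s := by positivity
          nlinarith
  rw [vOddDeriv, norm_mul, norm_div, norm_vOdd, Complex.norm_real, Real.norm_eq_abs, abs_of_pos h,
    ← hs, ← div_eq_mul_inv, inv_mul_eq_div, div_div, mul_comm (1 + x ^ 2) s, ← div_div]
  gcongr
  rwa [div_le_iff₀ hs0]

lemma integrable_vOddDeriv (lam : ℝ) (m : ℤ) : Integrable (vOddDeriv lam m) :=
  (integrable_inv_one_add_sq.const_mul _).mono' (continuous_vOddDeriv lam m).aestronglyMeasurable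
    (.of_forall (norm_vOddDeriv_le lam m))

lemma norm_vOddDeriv_sq_le (lam : ℝ) (m : ℤ) (x : ℝ) :
    ‖vOddDeriv lam m x‖ ^ 2 ≤ ((2 + |lam|) * (1 + |(m : ℝ)|)) ^ 2 * (1 + x ^ 2)⁻¹ := by
  have h : (1 + x ^ 2)⁻¹ ≤ 1 := inv_le_one_of_one_le₀ (by nlinarith)
  have h0 : 0 ≤ (1 + x ^ 2)⁻¹ := by positivity
  calc _ ≤ ((2 + |lam|) * (1 + |(m : ℝ)|) * (1 + x ^ 2)⁻¹) ^ 2 := by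
        gcongr
        exact norm_vOddDeriv_le lam m x
    _ = ((2 + |lam|) * (1 + |(m : ℝ)|)) ^ 2 * ((1 + x ^ 2)⁻¹ * (1 + x ^ 2)⁻¹) := by ring
    _ ≤ _ := by
        gcongr
        exact mul_le_of_le_one_right h0 h

lemma memLp_two_vOddDeriv (lam : ℝ) (m : ℤ) : MemLp (vOddDeriv lam m) 2 := by
  refine (memLp_two_iff_integrable_sq_norm (continuous_vOddDeriv lam m).aestronglyMeasurable).2 ?_
  refine (integrable_inv_one_add_sq.const_mul (((2 + |lam|) * (1 + |(m : ℝ)|)) ^ 2)).mono'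
    ((continuous_vOddDeriv lam m).norm.pow 2).aestronglyMeasurable (.of_forall fun x => ?_)
  rw [Real.norm_of_nonneg (by positivity)]
  exact norm_vOddDeriv_sq_le lam m x

lemma tendsto_vOdd_zero (lam : ℝ) (m : ℤ) {l : Filter ℝ}
    (hl : Tendsto (fun x : ℝ => |x|) l atTop) : Tendsto (vOdd lam m) l (nhds 0) := by
  rw [tendsto_zero_iff_norm_tendsto_zero]
  refine squeeze_zero' (g := fun x => |x|⁻¹) (.of_forall fun x => norm_nonneg _) ?_
    (tendsto_inv_atTop_zero.comp hl)
  filter_upwards [hl.eventually_gt_atTop 0] with x hx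
  rw [norm_vOdd]
  exact inv_anti₀ hx (Real.abs_le_sqrt (by linarith))

lemma lintegral_ofReal_inv_one_add_sq (C : ℝ) (hC : 0 ≤ C) :
    ∫⁻ x : ℝ, ENNReal.ofReal (C * (1 + x ^ 2)⁻¹) = ENNReal.ofReal (C * Real.pi) := by
  rw [← ofReal_integral_eq_lintegral_ofReal (integrable_inv_one_add_sq.const_mul C)
    (.of_forall fun x => by positivity), integral_const_mul, integral_univ_inv_one_add_sq]

lemma lintegral_enorm_vOdd_sq (lam : ℝ) (m : ℤ) :
    ∫⁻ x, ‖vOdd lam m x‖ₑ ^ 2 = ENNReal.ofReal Real.pi := by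
  have := lintegral_ofReal_inv_one_add_sq 1 zero_le_one
  rw [one_mul] at this
  rw [← this]
  refine lintegral_congr fun x => ?_
  rw [← ofReal_norm, ← ENNReal.ofReal_pow (norm_nonneg _), norm_vOdd, inv_pow,
    Real.sq_sqrt (by positivity), one_mul]

lemma lintegral_enorm_vOddDeriv_sq_le (lam : ℝ) (m : ℤ) :
    ∫⁻ x, ‖vOddDeriv lam m x‖ₑ ^ 2 ≤
      ENNReal.ofReal (((2 + |lam|) * (1 + |(m : ℝ)|)) ^ 2 * Real.pi) := by
  rw [← lintegral_ofReal_inv_one_add_sq _ (by positivity)]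
  refine lintegral_mono fun x => ?_
  rw [← ofReal_norm, ← ENNReal.ofReal_pow (norm_nonneg _)]
  exact ENNReal.ofReal_le_ofReal (norm_vOddDeriv_sq_le lam m x)

lemma exp_I_mul_arccot (x : ℝ) :
    Complex.exp (Complex.I * (arccot x : ℂ)) = (x + Complex.I) / (√(1 + x ^ 2) : ℝ) := by
  rw [mul_comm, Complex.exp_mul_I, ← Complex.ofReal_cos, ← Complex.ofReal_sin, arccot,
    Real.cos_pi_div_two_sub, Real.sin_pi_div_two_sub, Real.sin_arctan, Real.cos_arctan]
  push_cast
  ring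

/-- The rotation `k_θ` acts on the weight vector `vOdd lam m` by the scalar `e^{−i(2m+1)θ}`, off
the pole of the fractional linear action. -/
lemma piMinus_vOdd (lam θ : ℝ) (m : ℤ) {x : ℝ} (hx : Real.cos θ - x * Real.sin θ ≠ 0) :
    piMinus (Complex.I * lam) θ (vOdd lam m) x =
      Complex.exp (-(Complex.I * (2 * (m : ℂ) + 1) * θ)) * vOdd lam m x := by
  set d := Real.cos θ - x * Real.sin θ with hd
  set n := x * Real.cos θ + Real.sin θ with hn
  have hq : (0 : ℝ) < 1 + x ^ 2 := by positivity
  have hd0 : 0 < |d| := abs_pos.2 hx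
  have hnd : 1 + (n / d) ^ 2 = (1 + x ^ 2) / |d| ^ 2 := by
    rw [sq_abs]
    field_simp
    rw [hd, hn]
    linear_combination (1 + x ^ 2) * (Real.sin_sq_add_cos_sq θ)
  have hlog : Real.log (1 + (n / d) ^ 2) = Real.log (1 + x ^ 2) - 2 * Real.log |d| := by
    rw [hnd, Real.log_div hq.ne' (by positivity), Real.log_pow]
    norm_num
  have hsgn : (Real.sign d : ℝ) * |d| = d := by
    rcases lt_or_gt_of_ne hx with h | h
    · rw [Real.sign_of_neg h, abs_of_neg h]; ring
    · rw [Real.sign_of_pos h, abs_of_pos h]; ring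
  have hsgn2 : (Real.sign d : ℝ) ^ 2 = 1 := by
    rcases lt_or_gt_of_ne hx with h | h
    · rw [Real.sign_of_neg h]; norm_num
    · rw [Real.sign_of_pos h]; norm_num
  have hs0 : (√(1 + x ^ 2) : ℝ) ≠ 0 := (Real.sqrt_pos.2 hq).ne'
  have hphase : Complex.exp (Complex.I * (arccot (n / d) : ℂ)) =
      (Real.sign d : ℝ) * (Complex.exp (-(Complex.I * θ)) *
        Complex.exp (Complex.I * (arccot x : ℂ))) := by
    have hrot : ((n : ℂ) + Complex.I * d) = Complex.exp (-(Complex.I * θ)) * (x + Complex.I) := by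
      rw [show -(Complex.I * θ) = ((-θ : ℝ) : ℂ) * Complex.I by push_cast; ring, Complex.exp_mul_I,
        ← Complex.ofReal_cos, ← Complex.ofReal_sin, Real.cos_neg, Real.sin_neg, hn, hd]
      push_cast
      linear_combination Complex.sin θ * Complex.I_sq
    have hsC : ((Real.sign d : ℝ) : ℂ) * (|d| : ℝ) = d := by exact_mod_cast hsgn
    have hsC2 : ((Real.sign d : ℝ) : ℂ) ^ 2 = 1 := by exact_mod_cast hsgn2
    have hdC : (d : ℂ) ≠ 0 := by exact_mod_cast hx
    have hadC : ((|d| : ℝ) : ℂ) ≠ 0 := by exact_mod_cast hd0.ne'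
    have hsqC : ((√(1 + x ^ 2) : ℝ) : ℂ) ≠ 0 := by exact_mod_cast hs0
    rw [exp_I_mul_arccot, exp_I_mul_arccot, ← mul_div_assoc, ← hrot, hnd, Real.sqrt_div hq.le,
      Real.sqrt_sq hd0.le]
    push_cast
    field_simp
    linear_combination ((n : ℂ) + Complex.I * d) * (Real.sign d : ℝ) * hsC -
      ((|d| : ℝ) : ℂ) * ((n : ℂ) + Complex.I * d) * hsC2
  have hpow : ∀ z : ℂ, Complex.exp (Complex.I * (2 * (m : ℂ) + 1) * z) =
      Complex.exp (Complex.I * z) ^ (2 * m + 1) := fun z => by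
    rw [← Complex.exp_int_mul]
    congr 1
    push_cast
    ring
  have hneg : Complex.exp (-(Complex.I * (2 * (m : ℂ) + 1) * θ)) =
      Complex.exp (-(Complex.I * θ)) ^ (2 * m + 1) := by
    have := hpow (-(θ : ℂ))
    simpa only [mul_neg] using this
  have hsz : ((Real.sign d : ℝ) : ℂ) * ((Real.sign d : ℝ) : ℂ) ^ (2 * m + 1) = 1 := by
    have h0 : ((Real.sign d : ℝ) : ℂ) ≠ 0 := fun h => by
      have : Real.sign d = 0 := by exact_mod_cast h
      rw [this] at hsgn2; norm_num at hsgn2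
    rw [← zpow_one_add₀ h0, show 1 + (2 * m + 1) = 2 * (m + 1) by ring, zpow_mul]
    have : ((Real.sign d : ℝ) : ℂ) ^ (2 : ℤ) = 1 := by exact_mod_cast hsgn2
    rw [this, one_zpow]
  have hmod : ((|d| : ℝ) : ℂ) ^ (-1 - Complex.I * lam) *
      Complex.exp ((Real.log (1 + (n / d) ^ 2) : ℝ) * (-(1 + Complex.I * lam) / 2)) =
      Complex.exp ((Real.log (1 + x ^ 2) : ℝ) * (-(1 + Complex.I * lam) / 2)) := by
    rw [Complex.cpow_def_of_ne_zero (by exact_mod_cast hd0.ne'), ← Complex.ofReal_log hd0.le,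
      ← Complex.exp_add, hlog]
    congr 1
    push_cast
    ring
  rw [piMinus, ← hd, ← hn, vOdd_eq_exp, vOdd_eq_exp, Complex.exp_add, Complex.exp_add, hpow, hpow,
    hneg, hphase, mul_zpow, mul_zpow, ← hmod]
  linear_combination (((|d| : ℝ) : ℂ) ^ (-1 - Complex.I * lam) *
      Complex.exp ((Real.log (1 + (n / d) ^ 2) : ℝ) * (-(1 + Complex.I * lam) / 2)) *
      Complex.exp (-(Complex.I * θ)) ^ (2 * m + 1) *
      Complex.exp (Complex.I * (arccot x : ℂ)) ^ (2 * m + 1)) * hsz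

lemma piMinus_vOdd_ae_eq (lam θ : ℝ) (m : ℤ) :
    piMinus (Complex.I * lam) θ (vOdd lam m) =ᵐ[volume]
      fun x => Complex.exp (-(Complex.I * (2 * (m : ℂ) + 1) * θ)) * vOdd lam m x := by
  filter_upwards [compl_mem_ae_iff.2 (measure_singleton (Real.cos θ / Real.sin θ))] with x hx
  refine piMinus_vOdd lam θ m fun h => hx ?_
  have hs : Real.sin θ ≠ 0 := fun hs => by
    have hc : Real.cos θ = 0 := by simpa [hs] using h
    simpa [hs, hc] using Real.sin_sq_add_cos_sq θ
  rw [mem_singleton_iff, eq_div_iff hs]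
  linarith

lemma IsImpFT.const_mul {g : ℝ → ℂ} {ξ : ℝ} {z : ℂ} (h : IsImpFT g ξ z) (c : ℂ) :
    IsImpFT (fun x => c * g x) ξ (c * z) := by
  unfold IsImpFT at h ⊢
  simpa only [mul_assoc, integral_const_mul] using Tendsto.const_mul c h

lemma IsImpFT.congr_ae {f g : ℝ → ℂ} {ξ : ℝ} {z : ℂ} (h : IsImpFT g ξ z) (hfg : f =ᵐ[volume] g) :
    IsImpFT f ξ z := by
  unfold IsImpFT at h ⊢
  refine h.congr fun R => integral_congr_ae ?_
  filter_upwards [ae_restrict_of_ae hfg] with x hx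
  rw [hx]

/-- Interpolation of a weighted `L²` norm between the unweighted and the `|ξ|²`-weighted one. -/
lemma lintegral_rpow_mul_enorm_sq_le {G H : ℝ → ℂ} {a M A B : ℝ} (ha : a ∈ Ioo (0 : ℝ) 1)
    (hM : 0 < M) (hA : 0 ≤ A) (hB : 0 ≤ B) (hH : Continuous H)
    (hGH : ∀ ξ : ℝ, |ξ| * ‖G ξ‖ ≤ ‖H ξ‖)
    (hGA : ∫⁻ ξ, ‖G ξ‖ₑ ^ 2 ≤ ENNReal.ofReal A) (hHB : ∫⁻ ξ, ‖H ξ‖ₑ ^ 2 ≤ ENNReal.ofReal B) :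
    ∫⁻ ξ, ENNReal.ofReal (|ξ| ^ a) * ‖G ξ‖ₑ ^ 2 ≤
      ENNReal.ofReal (M ^ a * A + M ^ (a - 2) * B) := by
  have hpt : ∀ ξ, ENNReal.ofReal (|ξ| ^ a) * ‖G ξ‖ₑ ^ 2 ≤
      ENNReal.ofReal (M ^ a) * ‖G ξ‖ₑ ^ 2 + ENNReal.ofReal (M ^ (a - 2)) * ‖H ξ‖ₑ ^ 2 := fun ξ => by
    simp only [← ofReal_norm, ← ENNReal.ofReal_pow (norm_nonneg _)]
    rw [← ENNReal.ofReal_mul (by positivity), ← ENNReal.ofReal_mul (by positivity),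
      ← ENNReal.ofReal_mul (by positivity), ← ENNReal.ofReal_add (by positivity) (by positivity)]
    refine ENNReal.ofReal_le_ofReal ?_
    calc _ ≤ (M ^ a + M ^ (a - 2) * |ξ| ^ 2) * ‖G ξ‖ ^ 2 := by
          gcongr
          exact abs_rpow_le_add ha hM ξ
      _ = M ^ a * ‖G ξ‖ ^ 2 + M ^ (a - 2) * (|ξ| * ‖G ξ‖) ^ 2 := by ring
      _ ≤ _ := by
          gcongr
          exact hGH ξ
  refine (lintegral_mono hpt).trans ?_
  rw [lintegral_add_right _ ((hH.enorm.measurable.pow_const 2).const_mul _),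
    lintegral_const_mul' _ _ ENNReal.ofReal_ne_top, lintegral_const_mul' _ _ ENNReal.ofReal_ne_top,
    ENNReal.ofReal_add (by positivity) (by positivity), ENNReal.ofReal_mul (by positivity),
    ENNReal.ofReal_mul (by positivity)]
  gcongr

/-- for `u ∈ (−1,0)` the K-averaged complementary norm
`⫴v_{2m+1}^{(iλ)}⫴²_u = ∫₀^{2π} ∫ |ξ|^{−u} |𝓕(π_{iλ,−}(k_θ)v_{2m+1}^{(iλ)})(ξ)|² dξ dθ`
is bounded by `c_u (1+|m|)^{−u}`, the improper Fourier transforms existing for `ξ ≠ 0`. -/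
theorem stmt16 (u lam : ℝ) (hu : u ∈ Set.Ioo (-1 : ℝ) 0) :
    ∃ c : ℝ, 0 < c ∧
      ∀ m : ℤ, ∃ F : ℝ → ℝ → ℂ,
        (∀ θ : ℝ, ∀ ξ : ℝ, ξ ≠ 0 →
          IsImpFT (piMinus (Complex.I * lam) θ (vOdd lam m)) ξ (F θ ξ)) ∧
        (∫⁻ θ in Ioc (0:ℝ) (2 * π),
            ∫⁻ ξ : ℝ, ENNReal.ofReal (|ξ| ^ (-u)) * (‖F θ ξ‖₊ : ℝ≥0∞) ^ 2)
          ≤ ENNReal.ofReal (c * (1 + |(m : ℝ)|) ^ (-u)) := by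
  obtain ⟨hu1, hu0⟩ := hu
  have ha : -u ∈ Ioo (0 : ℝ) 1 := ⟨by linarith, by linarith⟩
  refine ⟨2 * Real.pi * (Real.pi * (1 + (2 + |lam|) ^ 2)), by positivity, fun m => ?_⟩
  set G : ℝ → ℂ := fun ξ => 𝓕 (vOddDeriv lam m) ξ / (2 * Real.pi * Complex.I * ξ) with hG
  have hGft : ∀ ξ : ℝ, ξ ≠ 0 → IsImpFT (vOdd lam m) ξ (G ξ) := fun ξ hξ =>
    isImpFT_of_hasDerivAt (hasDerivAt_vOdd lam m) (continuous_vOddDeriv lam m)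
      (integrable_vOddDeriv lam m) (tendsto_vOdd_zero lam m tendsto_abs_atBot_atTop)
      (tendsto_vOdd_zero lam m tendsto_abs_atTop_atTop) hξ
  refine ⟨fun θ ξ => Complex.exp (-(Complex.I * (2 * (m : ℂ) + 1) * θ)) * G ξ,
    fun θ ξ hξ => ((hGft ξ hξ).const_mul _).congr_ae (piMinus_vOdd_ae_eq lam θ m), ?_⟩
  set M : ℝ := 1 + |(m : ℝ)| with hM
  have hM0 : 0 < M := by positivity
  have hGH : ∀ ξ : ℝ, |ξ| * ‖G ξ‖ ≤ ‖𝓕 (vOddDeriv lam m) ξ‖ := fun ξ => by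
    rcases eq_or_ne ξ 0 with rfl | hξ
    · simp
    · have hξ' : 0 < |ξ| := abs_pos.2 hξ
      have hn : ‖(2 * Real.pi * Complex.I * ξ : ℂ)‖ = 2 * Real.pi * |ξ| := by
        simp [abs_of_pos Real.pi_pos]
      rw [hG]
      simp only [norm_div, hn]
      rw [mul_div_assoc', div_le_iff₀ (by positivity), mul_comm]
      gcongr
      nlinarith [Real.pi_gt_three]
  have hGA : ∫⁻ ξ, ‖G ξ‖ₑ ^ 2 ≤ ENNReal.ofReal Real.pi :=
    (IsImpFT.lintegral_enorm_sq_le (continuous_vOdd lam m) hGft).trans_eq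
      (lintegral_enorm_vOdd_sq lam m)
  have hHB : ∫⁻ ξ, ‖𝓕 (vOddDeriv lam m) ξ‖ₑ ^ 2 ≤
      ENNReal.ofReal (((2 + |lam|) * M) ^ 2 * Real.pi) :=
    (lintegral_enorm_fourier_sq (integrable_vOddDeriv lam m) (memLp_two_vOddDeriv lam m)).trans_le
      (lintegral_enorm_vOddDeriv_sq_le lam m)
  have hmain := lintegral_rpow_mul_enorm_sq_le ha hM0 Real.pi_pos.le (by positivity)
    (continuous_fourier (integrable_vOddDeriv lam m)) hGH hGA hHB
  have hMa : M ^ (-u) * Real.pi + M ^ (-u - 2) * (((2 + |lam|) * M) ^ 2 * Real.pi) =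
      Real.pi * (1 + (2 + |lam|) ^ 2) * M ^ (-u) := by
    have : M ^ (-u) = M ^ (-u - 2) * M ^ 2 := by
      rw [← Real.rpow_natCast, ← Real.rpow_add hM0]; norm_num
    rw [this]
    ring
  rw [hMa] at hmain
  have hunit : ∀ θ : ℝ, ‖Complex.exp (-(Complex.I * (2 * (m : ℂ) + 1) * θ))‖ = 1 := fun θ => by
    rw [Complex.norm_exp]
    simp
  have hinner : ∀ θ : ℝ, ∫⁻ ξ : ℝ, ENNReal.ofReal (|ξ| ^ (-u)) *
      (‖Complex.exp (-(Complex.I * (2 * (m : ℂ) + 1) * θ)) * G ξ‖₊ : ℝ≥0∞) ^ 2 ≤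
      ENNReal.ofReal (Real.pi * (1 + (2 + |lam|) ^ 2) * M ^ (-u)) := fun θ => by
    refine le_of_eq_of_le (lintegral_congr fun ξ => ?_) hmain
    rw [← enorm_eq_nnnorm, ← ofReal_norm, norm_mul, hunit, one_mul, ofReal_norm]
  refine (lintegral_mono fun θ => hinner θ).trans_eq ?_
  rw [setLIntegral_const, Real.volume_Ioc, sub_zero, ← ENNReal.ofReal_mul (by positivity)]
  congr 1
  ring
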